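/- arXiv:2406.07265 — 4 statements merged into one kernel-verified Lean document; each statement's English description precedes it below -/
import Mathlib

section
/- For every m ≥ 1 and every k ∈ ℤ, the determinants t^{(m)}_k satisfy the recurrence t^{(m)}_k(x) = t^{(m−1)}_1(x) · t_k(q^{−m}x) − t^{(m−1)}_{k+1}(x), as an identity of rational functions in x. In particular, since t^{(m)}_k = 0 for k > n, one has t^{(m)}_n(x) = t^{(m−1)}_1(x) · t_n(q^{−m}x). -/
open Polynomial

noncomputable section

/-- The rational function `x ↦ f (c * x)`. -/
def qshift (c : ℂ) (f : RatFunc ℂ) : RatFunc ℂ :=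
  algebraMap (Polynomial ℂ) (RatFunc ℂ) (f.num.comp (C c * X)) /
    algebraMap (Polynomial ℂ) (RatFunc ℂ) (f.denom.comp (C c * X))

/-- `t_k = a_k / a_0`, with the convention `t_k = 0` for `k < 0` or `k > n`. -/
def tcoef (n : ℕ) (a : ℕ → Polynomial ℂ) (k : ℤ) : RatFunc ℂ :=
  if 0 ≤ k ∧ k ≤ (n : ℤ) then
    algebraMap (Polynomial ℂ) (RatFunc ℂ) (a k.toNat) /
      algebraMap (Polynomial ℂ) (RatFunc ℂ) (a 0)
  else 0

/-- The `(m+1) × (m+1)` determinant defining `t^{(m)}_k` for `m ≥ 1`: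
its `(i,j)` entry (`0`-based) is `t_{j-i+1}(q^{-i} x)` for `j < m`, and its last column has
entries `t_{k+m-i}(q^{-i} x)`. -/
def tdet (q : ℂ) (t : ℤ → RatFunc ℂ) (m : ℕ) (k : ℤ) : RatFunc ℂ :=
  Matrix.det (Matrix.of fun i j : Fin (m + 1) =>
    if (j : ℕ) < m then qshift (q ^ (-((i : ℕ) : ℤ))) (t (((j : ℕ) : ℤ) - ((i : ℕ) : ℤ) + 1))
    else qshift (q ^ (-((i : ℕ) : ℤ))) (t (k + (m : ℤ) - ((i : ℕ) : ℤ))))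

/-- `t^{(m)}_k`, with `t^{(0)}_k = t_k` and `t^{(m)}_k = (-1)^{k-1} δ_{k+m,0}` for `m < 0`. -/
def tmk (q : ℂ) (t : ℤ → RatFunc ℂ) (m : ℤ) (k : ℤ) : RatFunc ℂ :=
  if m < 0 then (if k + m = 0 then (-1 : RatFunc ℂ) ^ (k - 1) else 0)
  else if m = 0 then t k
  else tdet q t m.toNat k

theorem qshift_zero (c : ℂ) : qshift c 0 = 0 := by simp [qshift]

theorem qshift_one (c : ℂ) : qshift c 1 = 1 := by simp [qshift]

theorem one_qshift (f : RatFunc ℂ) : qshift 1 f = f := by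
  simp [qshift, RatFunc.num_div_denom]

theorem tcoef_of_neg (n : ℕ) (a : ℕ → Polynomial ℂ) {k : ℤ} (hk : k < 0) :
    tcoef n a k = 0 :=
  if_neg fun h => hk.not_ge h.1

theorem tcoef_of_gt (n : ℕ) (a : ℕ → Polynomial ℂ) {k : ℤ} (hk : (n : ℤ) < k) :
    tcoef n a k = 0 :=
  if_neg fun h => hk.not_ge h.2

theorem tcoef_zero (n : ℕ) (a : ℕ → Polynomial ℂ) (ha : a 0 ≠ 0) : tcoef n a 0 = 1 := by
  have h : algebraMap (Polynomial ℂ) (RatFunc ℂ) (a 0) ≠ 0 := RatFunc.algebraMap_ne_zero ha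
  simp [tcoef, div_self h]

theorem tmk_natCast (q : ℂ) (t : ℤ → RatFunc ℂ) (m : ℕ) (k : ℤ) :
    tmk q t m k = tdet q t m k := by
  rcases m with _ | m
  · simp [tmk, tdet, one_qshift]
  · have h₁ : ¬ ((m + 1 : ℕ) : ℤ) < 0 := by lia
    have h₂ : ((m + 1 : ℕ) : ℤ) ≠ 0 := by lia
    rw [tmk, if_neg h₁, if_neg h₂, Int.toNat_natCast]

/-- Expansion along a last row in which only the last two entries may be nonzero. -/
theorem Matrix.det_of_last_row_eq_zero {R : Type*} [CommRing R] {r : ℕ}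
    (A : Matrix (Fin (r + 2)) (Fin (r + 2)) R)
    (hA : ∀ j : Fin r, A (Fin.last (r + 1)) j.castSucc.castSucc = 0) :
    A.det = A (Fin.last (r + 1)) (Fin.last (r + 1)) *
        (A.submatrix Fin.castSucc Fin.castSucc).det -
      A (Fin.last (r + 1)) (Fin.last r).castSucc *
        (A.submatrix Fin.castSucc (Fin.last r).castSucc.succAbove).det := by
  rw [Matrix.det_succ_row A (Fin.last (r + 1)), Fin.sum_univ_castSucc, Fin.sum_univ_castSucc]
  have h₁ : (-1 : R) ^ (r + 1 + r) = -1 := Odd.neg_one_pow ⟨r, by ring⟩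
  have h₂ : (-1 : R) ^ (r + 1 + (r + 1)) = 1 := Even.neg_one_pow ⟨r + 1, rfl⟩
  simp [hA, h₁, h₂, Fin.succAbove_last]
  ring

theorem tdet_succ (q : ℂ) (t : ℤ → RatFunc ℂ) (ht : ∀ k < 0, t k = 0) (ht0 : t 0 = 1)
    (r : ℕ) (k : ℤ) :
    tdet q t (r + 1) k
      = tdet q t r 1 * qshift (q ^ (-((r + 1 : ℕ) : ℤ))) (t k) - tdet q t r (k + 1) := by
  rw [tdet, Matrix.det_of_last_row_eq_zero]
  · have h₁ : ∀ j : Fin (r + 1), (j : ℕ) < r →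
        (((Fin.last r).castSucc.succAbove j : Fin (r + 2)) : ℕ) = j := by
      intro j hj
      rw [Fin.succAbove_of_castSucc_lt _ _ (by simpa [Fin.lt_def] using hj)]
      simp
    rw [mul_comm (tdet q t r 1), tdet, tdet]
    congr 1
    · congr 1
      · simp only [Matrix.of_apply, Fin.val_last, lt_irrefl, if_false, add_sub_cancel_right]
      · congr 1
        ext i j
        have hj := j.isLt
        by_cases h : (j : ℕ) < r
        · simp [h, h.not_gt]
        · have hr : (j : ℕ) = r := by lia
          simp [hr, add_comm, add_sub_assoc, sub_add_eq_add_sub]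
    · rw [← one_mul (Matrix.det (Matrix.of fun i j : Fin (r + 1) => _))]
      congr 1
      · simp [ht0, qshift_one]
      · congr 1
        ext i j
        by_cases h : (j : ℕ) < r
        · have h' := h₁ j h
          simp [h, h', h.not_gt]
        · have hr : j = Fin.last r := Fin.ext (by simp; lia)
          subst hr
          simp [add_assoc, add_comm (1 : ℤ)]
  · intro j
    have hj : ((j : ℕ) : ℤ) - ((r + 1 : ℕ) : ℤ) + 1 < 0 := by have := j.isLt; lia
    simp only [Matrix.of_apply, Fin.val_castSucc, Fin.val_last]
    rw [if_pos (by lia), ht _ hj, qshift_zero]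

theorem tdet_eq_zero (q : ℂ) (t : ℤ → RatFunc ℂ) {k : ℤ} (ht : ∀ l, k ≤ l → t l = 0)
    (r : ℕ) : tdet q t r k = 0 := by
  refine Matrix.det_eq_zero_of_column_eq_zero (Fin.last r) fun i => ?_
  have hi := i.isLt
  simp only [Matrix.of_apply, Fin.val_last, lt_irrefl, if_false]
  rw [ht _ (by lia), qshift_zero]

/-- for `m ≥ 1` and `k ∈ ℤ`,
`t^{(m)}_k(x) = t^{(m-1)}_1(x) · t_k(q^{-m} x) − t^{(m-1)}_{k+1}(x)`, and in particular
`t^{(m)}_n(x) = t^{(m-1)}_1(x) · t_n(q^{-m} x)`. -/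
theorem tmk_recurrence (q : ℂ) (hq0 : q ≠ 0) (hq1 : ‖q‖ < 1)
    (n : ℕ) (a : ℕ → Polynomial ℂ) (ha : a 0 ≠ 0) :
    ∀ m : ℤ, 1 ≤ m → ∀ k : ℤ,
      (tmk q (tcoef n a) m k
        = tmk q (tcoef n a) (m - 1) 1 * qshift (q ^ (-m)) (tcoef n a k)
          - tmk q (tcoef n a) (m - 1) (k + 1))
      ∧ tmk q (tcoef n a) m (n : ℤ)
        = tmk q (tcoef n a) (m - 1) 1 * qshift (q ^ (-m)) (tcoef n a (n : ℤ)) := by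
  intro m hm
  obtain ⟨r, rfl⟩ : ∃ r : ℕ, m = ((r + 1 : ℕ) : ℤ) := ⟨(m - 1).toNat, by lia⟩
  have hr : ((r + 1 : ℕ) : ℤ) - 1 = (r : ℤ) := by lia
  have key := tdet_succ q (tcoef n a) (fun _ => tcoef_of_neg n a) (tcoef_zero n a ha) r
  simp only [hr, tmk_natCast]
  intro k
  refine ⟨key k, ?_⟩
  rw [key, tdet_eq_zero q (tcoef n a) (k := n + 1) fun l hl => tcoef_of_gt n a (by lia), sub_zero]

end
end

section
/- Let L = a_0(x)σ_q^2 − a_1(x)σ_q + a_2(x) be a second order q-difference operator with polynomial coefficients, let s ∈ ℂ^× and r ∈ ℤ_{>0}. Assume a_0(x) has a simple zero at x = s, the polynomial a_2(q^{−r}x) has a simple zero at x = s (i.e. a_2 has a simple zero at q^{−r}s), and neither a_0 nor a_2 has any other zero of the form q^j s, j ∈ ℤ. Then x = s and x = q^{−r}s are apparent singularities of the companion system Y(qx) = A(x)Y(x) if and only if Δ_r(s) = 0. -/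
open Polynomial

noncomputable section

/-- The rational function `x ↦ p (c * x)` associated with a polynomial `p`. -/
def pshift (c : ℂ) (p : Polynomial ℂ) : RatFunc ℂ :=
  algebraMap (Polynomial ℂ) (RatFunc ℂ) (p.comp (C c * X))

/-- A matrix of rational functions is *regular* at `s` if all its entries are
holomorphic at `s` and the value matrix at `s` is invertible. -/
def RegularAt {n : ℕ} (M : Matrix (Fin n) (Fin n) (RatFunc ℂ)) (s : ℂ) : Prop :=
  (∀ i j, (M i j).denom.eval s ≠ 0) ∧
    (Matrix.of fun i j => RatFunc.eval (RingHom.id ℂ) s (M i j)).det ≠ 0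

/-- `s` is an apparent singularity of the system `Y(qx) = A(x) Y(x)` if the product
`A(q^N x) A(q^{N-1} x) ⋯ A(q^{-N'} x)` is regular at `x = s` for all large `N, N'`. -/
def IsApparent {n : ℕ} (q : ℂ) (A : Matrix (Fin n) (Fin n) (RatFunc ℂ)) (s : ℂ) : Prop :=
  ∃ N0 : ℕ, ∀ N N' : ℕ, N0 ≤ N → N0 ≤ N' →
    RegularAt (((List.range (N + N' + 1)).map fun k =>
      A.map (qshift (q ^ ((N : ℤ) - (k : ℤ))))).prod) s

/-- The tridiagonal determinant `Δ_r(x)`. -/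
def Delta (q : ℂ) (a0 a1 a2 : Polynomial ℂ) (r : ℕ) : RatFunc ℂ :=
  Matrix.det (Matrix.of fun i j : Fin (r + 1) =>
    if (i : ℕ) = (j : ℕ) + 1 then pshift (q ^ (-((i : ℕ) : ℤ))) a0
    else if (i : ℕ) = (j : ℕ) then pshift (q ^ (-((i : ℕ) : ℤ))) a1
    else if (j : ℕ) = (i : ℕ) + 1 then pshift (q ^ (-((i : ℕ) : ℤ))) a2
    else 0)

/-- The `2 × 2` companion matrix `A(x) = [[a_1/a_0, -a_2/a_0], [1, 0]]`. -/
def Amat (a0 a1 a2 : Polynomial ℂ) : Matrix (Fin 2) (Fin 2) (RatFunc ℂ) :=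
  !![algebraMap (Polynomial ℂ) (RatFunc ℂ) a1 / algebraMap (Polynomial ℂ) (RatFunc ℂ) a0,
      -(algebraMap (Polynomial ℂ) (RatFunc ℂ) a2 / algebraMap (Polynomial ℂ) (RatFunc ℂ) a0);
     1, 0]

/-- A tridiagonal matrix whose row `i` has subdiagonal, diagonal and superdiagonal
entries `a i`, `b i` and `c i`. -/
def tridiagonal {R : Type*} [CommRing R] (a b c : ℕ → R) (n : ℕ) : Matrix (Fin n) (Fin n) R :=
  Matrix.of fun i j =>
    if (i : ℕ) = (j : ℕ) + 1 then a i
    else if (i : ℕ) = (j : ℕ) then b i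
    else if (j : ℕ) = (i : ℕ) + 1 then c i
    else 0

theorem det_tridiagonal_succ_succ {R : Type*} [CommRing R] (a b c : ℕ → R) (n : ℕ) :
    (tridiagonal a b c (n + 2)).det =
      b (n + 1) * (tridiagonal a b c (n + 1)).det
        - a (n + 1) * c n * (tridiagonal a b c n).det := by
  have minor : ((tridiagonal a b c (n + 2)).submatrix (Fin.last (n + 1)).succAbove
      (Fin.last n).castSucc.succAbove).det = c n * (tridiagonal a b c n).det := by
    rw [Matrix.det_succ_column _ (Fin.last n), Finset.sum_eq_single (Fin.last n)]
    · have : ((tridiagonal a b c (n + 2)).submatrix (Fin.last (n + 1)).succAbove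
          (Fin.last n).castSucc.succAbove).submatrix (Fin.last n).succAbove
          (Fin.last n).succAbove = tridiagonal a b c n := by
        ext i j
        simp [tridiagonal, Fin.succAbove, Fin.lt_def]
      rw [this]
      have h1 : n ≠ n + 1 + 1 := by omega
      simp [tridiagonal, Fin.succAbove, h1, ← two_mul]
    · intro i _ hi
      have hi' : (i : ℕ) < n := Fin.val_lt_last hi
      have h1 : (i : ℕ) ≠ n + 1 + 1 := by omega
      have h2 : (i : ℕ) ≠ n + 1 := by omega
      have h3 : n ≠ (i : ℕ) := by omega
      simp [tridiagonal, Fin.succAbove, h1, h2, h3]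
    · simp
  rw [Matrix.det_succ_row _ (Fin.last (n + 1)),
    Fin.sum_univ_castSucc, Finset.sum_eq_single (Fin.last n)]
  · have : (tridiagonal a b c (n + 2)).submatrix (Fin.last (n + 1)).succAbove
        (Fin.last (n + 1)).succAbove = tridiagonal a b c (n + 1) := by
      ext i j
      simp [tridiagonal]
    rw [minor, this]
    have e1 : (-1 : R) ^ (n + 1 + n) = -1 := Odd.neg_one_pow ⟨n, by ring⟩
    have e2 : (-1 : R) ^ (n + 1 + (n + 1)) = 1 := Even.neg_one_pow ⟨n + 1, by ring⟩
    simp [tridiagonal, e1, e2]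
    ring
  · intro j _ hj
    have hj' : (j : ℕ) < n := Fin.val_lt_last hj
    have h1 : n ≠ (j : ℕ) := by omega
    have h2 : n + 1 ≠ (j : ℕ) := by omega
    have h3 : (j : ℕ) ≠ n + 1 + 1 := by omega
    simp [tridiagonal, h1, h2, h3]
  · simp

/-- The companion matrix with its denominator cleared. -/
def companionNum {R : Type*} [CommRing R] (a b c : R) : Matrix (Fin 2) (Fin 2) R :=
  !![b, -c; a, 0]

theorem det_companionNum {R : Type*} [CommRing R] (a b c : R) :
    (companionNum a b c).det = a * c := by
  simp [companionNum, Matrix.det_fin_two]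
  ring

theorem companionNum_map {R S : Type*} [CommRing R] [CommRing S] (f : R →+* S) (a b c : R) :
    (companionNum a b c).map f = companionNum (f a) (f b) (f c) := by
  ext i j
  fin_cases i <;> fin_cases j <;> simp [companionNum]

theorem map_list_prod_companionNum {R S : Type*} [CommRing R] [CommRing S] (f : R →+* S)
    (a b c : ℕ → R) (l : List ℕ) :
    (l.map fun k => companionNum (a k) (b k) (c k)).prod.map f =
      (l.map fun k => companionNum (f (a k)) (f (b k)) (f (c k))).prod := by
  rw [← RingHom.mapMatrix_apply, map_list_prod, List.map_map]
  congr 2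
  funext k
  simp [companionNum_map]

theorem det_list_prod_companionNum {R : Type*} [CommRing R] (a b c : ℕ → R) (n : ℕ) :
    ((List.range n).map fun k => companionNum (a k) (b k) (c k)).prod.det =
      (∏ k ∈ Finset.range n, a k) * ∏ k ∈ Finset.range n, c k := by
  induction n with
  | zero => simp
  | succ n ih =>
    rw [List.prod_range_succ, Matrix.det_mul, ih, det_companionNum, Finset.prod_range_succ,
      Finset.prod_range_succ]
    ring

/-- If `a 0 = 0`, the product of cleared companion matrices has zero second row, and its first
row consists of tridiagonal determinants. -/
theorem list_prod_companionNum_eq {R : Type*} [CommRing R] (a b c : ℕ → R) (h0 : a 0 = 0)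
    (n : ℕ) :
    ((List.range (n + 1)).map fun k => companionNum (a k) (b k) (c k)).prod =
      !![(tridiagonal a b c (n + 1)).det, -(c n * (tridiagonal a b c n).det); 0, 0] := by
  induction n with
  | zero =>
    simp [companionNum, h0, tridiagonal]
  | succ n ih =>
    rw [List.prod_range_succ, ih, det_tridiagonal_succ_succ]
    ext i j
    fin_cases i <;> fin_cases j <;> simp [companionNum, Matrix.mul_apply, Fin.sum_univ_two] <;> ring

theorem list_prod_companionNum_eq_zero_iff {R : Type*} [CommRing R] (a b c : ℕ → R) (r : ℕ)
    (h0 : a 0 = 0) (hr : c r = 0) :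
    ((List.range (r + 1)).map fun k => companionNum (a k) (b k) (c k)).prod = 0 ↔
      (tridiagonal a b c (r + 1)).det = 0 := by
  rw [list_prod_companionNum_eq a b c h0, hr]
  constructor
  · intro h
    simpa using congrFun (congrFun h 0) 0
  · intro h
    rw [h]
    ext i j
    fin_cases i <;> fin_cases j <;> simp

/-- Invertible factors outside a block of consecutive factors do not affect whether the product
vanishes. -/
theorem list_prod_eq_zero_iff_of_isUnit {M : Type*} [MonoidWithZero M] (f : ℕ → M) (u n v : ℕ)
    (h1 : ∀ k < u, IsUnit (f k)) (h2 : ∀ k, u + n ≤ k → IsUnit (f k)) :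
    ((List.range (u + n + v)).map f).prod = 0 ↔
      ((List.range n).map fun k => f (u + k)).prod = 0 := by
  have hu : IsUnit ((List.range u).map f).prod := by
    apply List.prod_isUnit
    simpa using h1
  have hv : IsUnit ((List.range v).map fun k => f (u + n + k)).prod := by
    apply List.prod_isUnit
    simp only [List.mem_map, List.mem_range, forall_exists_index, and_imp]
    rintro _ k _ rfl
    exact h2 _ (by omega)
  rw [List.range_add, List.map_append, List.prod_append, List.range_add, List.map_append,
    List.prod_append, List.map_map, List.map_map]
  rw [show (f ∘ fun x => u + n + x) = fun k => f (u + n + k) from rfl,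
    show (f ∘ fun x => u + x) = fun k => f (u + k) from rfl,
    hv.mul_left_eq_zero, hu.mul_right_eq_zero]

theorem comp_C_mul_X_ne_zero {c : ℂ} (hc : c ≠ 0) {p : Polynomial ℂ} (hp : p ≠ 0) :
    p.comp (C c * X) ≠ 0 := fun h =>
  hp ((comp_C_mul_X_eq_zero_iff (mem_nonZeroDivisors_of_ne_zero hc)).1 h)

theorem qshift_div {c : ℂ} (hc : c ≠ 0) (p d : Polynomial ℂ) (hd : d ≠ 0) :
    qshift c (algebraMap (Polynomial ℂ) (RatFunc ℂ) p / algebraMap (Polynomial ℂ) (RatFunc ℂ) d) =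
      algebraMap (Polynomial ℂ) (RatFunc ℂ) (p.comp (C c * X)) /
        algebraMap (Polynomial ℂ) (RatFunc ℂ) (d.comp (C c * X)) := by
  set f := algebraMap (Polynomial ℂ) (RatFunc ℂ) p / algebraMap (Polynomial ℂ) (RatFunc ℂ) d
    with hf
  have h : f.num * d = p * f.denom := (RatFunc.num_mul_eq_mul_denom_iff hd).2 hf
  have h' := congrArg (fun u => u.comp (C c * X)) h
  simp only [mul_comp] at h'
  rw [qshift, div_eq_div_iff
    (RatFunc.algebraMap_ne_zero (comp_C_mul_X_ne_zero hc f.denom_ne_zero))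
    (RatFunc.algebraMap_ne_zero (comp_C_mul_X_ne_zero hc hd)), ← map_mul, ← map_mul, h']

theorem Amat_map_qshift {c : ℂ} (hc : c ≠ 0) (a0 a1 a2 : Polynomial ℂ) (ha0 : a0 ≠ 0) :
    (Amat a0 a1 a2).map (qshift c) =
      (algebraMap (Polynomial ℂ) (RatFunc ℂ) (a0.comp (C c * X)))⁻¹ •
        (companionNum (a0.comp (C c * X)) (a1.comp (C c * X)) (a2.comp (C c * X))).map
          (algebraMap (Polynomial ℂ) (RatFunc ℂ)) := by
  have h := RatFunc.algebraMap_ne_zero (comp_C_mul_X_ne_zero hc ha0)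
  have hneg : qshift c (-(algebraMap (Polynomial ℂ) (RatFunc ℂ) a2 /
      algebraMap (Polynomial ℂ) (RatFunc ℂ) a0)) = -(algebraMap (Polynomial ℂ) (RatFunc ℂ)
        (a2.comp (C c * X)) / algebraMap (Polynomial ℂ) (RatFunc ℂ) (a0.comp (C c * X))) := by
    have e := qshift_div hc (-a2) a0 ha0
    rw [neg_comp, map_neg, map_neg] at e
    convert e using 1
    · congr 1
      ring
    · ring
  have h1 : qshift c 1 = 1 := by simp [qshift]
  have h0 : qshift c 0 = 0 := by simp [qshift]
  ext i j
  fin_cases i <;> fin_cases j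
  · simp [Amat, companionNum, qshift_div hc _ _ ha0]
    ring
  · simp [Amat, companionNum, hneg]
    ring
  · simp [Amat, companionNum, h1, h]
  · simp [Amat, companionNum, h0]

theorem list_prod_Amat (c : ℕ → ℂ) (hc : ∀ k, c k ≠ 0) (a0 a1 a2 : Polynomial ℂ)
    (ha0 : a0 ≠ 0) (n : ℕ) :
    ((List.range n).map fun k => (Amat a0 a1 a2).map (qshift (c k))).prod =
      (algebraMap (Polynomial ℂ) (RatFunc ℂ)
        (∏ k ∈ Finset.range n, a0.comp (C (c k) * X)))⁻¹ •
        ((List.range n).map fun k => companionNum (a0.comp (C (c k) * X))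
          (a1.comp (C (c k) * X)) (a2.comp (C (c k) * X))).prod.map
            (algebraMap (Polynomial ℂ) (RatFunc ℂ)) := by
  induction n with
  | zero => simp
  | succ n ih =>
    rw [List.prod_range_succ, ih, List.prod_range_succ, Amat_map_qshift (hc n) _ _ _ ha0,
      Matrix.map_mul, Finset.prod_range_succ, map_mul, mul_inv, Matrix.smul_mul, Matrix.mul_smul,
      smul_smul]

theorem eval_div_of_eval_ne_zero (p d : Polynomial ℂ) (x : ℂ) (hd : d.eval x ≠ 0) :
    (algebraMap (Polynomial ℂ) (RatFunc ℂ) p /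
      algebraMap (Polynomial ℂ) (RatFunc ℂ) d).denom.eval x ≠ 0 ∧
    RatFunc.eval (RingHom.id ℂ) x (algebraMap (Polynomial ℂ) (RatFunc ℂ) p /
      algebraMap (Polynomial ℂ) (RatFunc ℂ) d) = p.eval x / d.eval x := by
  have hd0 : d ≠ 0 := by
    rintro rfl
    simp at hd
  set f := algebraMap (Polynomial ℂ) (RatFunc ℂ) p / algebraMap (Polynomial ℂ) (RatFunc ℂ) d
    with hf
  have h : f.num * d = p * f.denom := (RatFunc.num_mul_eq_mul_denom_iff hd0).2 hf
  have hden : f.denom.eval x ≠ 0 := by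
    obtain ⟨w, hw⟩ := (RatFunc.denom_dvd hd0).2 ⟨p, hf⟩
    intro h0
    apply hd
    rw [hw, eval_mul, h0, zero_mul]
  refine ⟨hden, ?_⟩
  have h' := congrArg (eval x) h
  simp only [eval_mul] at h'
  rw [RatFunc.eval, eval₂_id, eval₂_id, div_eq_div_iff hden hd, h']

/-- If the denominator `d` of a matrix has a simple zero at `x` and the determinant of its
numerator has a zero of order exactly `n`, then regularity at `x` amounts to the vanishing of the
numerator at `x`. -/
theorem regularAt_inv_smul_iff {n : ℕ} (N : Matrix (Fin n) (Fin n) (Polynomial ℂ))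
    (d e g : Polynomial ℂ) (x : ℂ) (hd : d = (X - C x) * e) (he : e.eval x ≠ 0)
    (hN : N.det = (X - C x) ^ n * g) (hg : g.eval x ≠ 0) :
    RegularAt ((algebraMap (Polynomial ℂ) (RatFunc ℂ) d)⁻¹ •
      N.map (algebraMap (Polynomial ℂ) (RatFunc ℂ))) x ↔ N.map (evalRingHom x) = 0 := by
  have hX : (X - C x : Polynomial ℂ) ≠ 0 := X_sub_C_ne_zero x
  have he0 : e ≠ 0 := by
    rintro rfl
    simp at he
  have hd0 : d ≠ 0 := hd ▸ mul_ne_zero hX he0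
  have entry : ∀ i j, ((algebraMap (Polynomial ℂ) (RatFunc ℂ) d)⁻¹ •
      N.map (algebraMap (Polynomial ℂ) (RatFunc ℂ))) i j =
        algebraMap (Polynomial ℂ) (RatFunc ℂ) (N i j) /
          algebraMap (Polynomial ℂ) (RatFunc ℂ) d := fun i j => by
    simp [div_eq_inv_mul]
  constructor
  · rintro ⟨h, -⟩
    ext i j
    have hij := h i j
    rw [entry] at hij
    have key := congrArg (eval x) ((RatFunc.num_mul_eq_mul_denom_iff hd0).2
      (rfl : algebraMap (Polynomial ℂ) (RatFunc ℂ) (N i j) /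
          algebraMap (Polynomial ℂ) (RatFunc ℂ) d = _))
    rw [eval_mul, eval_mul, hd] at key
    simp only [eval_mul, eval_sub, eval_X, eval_C, sub_self, zero_mul, mul_zero] at key
    rw [← hd] at key
    simpa [hij] using key.symm
  · intro h
    have hdvd : ∀ i j, ∃ w, N i j = (X - C x) * w := fun i j =>
      dvd_iff_isRoot.2 (by simpa using congrFun (congrFun h i) j)
    choose W hW using hdvd
    have hNW : N = (X - C x) • Matrix.of W := by
      ext1 i j
      simp [hW]
    have hdetW : (Matrix.of W).det = g := by
      rw [hNW, Matrix.det_smul, Fintype.card_fin] at hN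
      exact mul_left_cancel₀ (pow_ne_zero n hX) hN
    have entry' : ∀ i j, ((algebraMap (Polynomial ℂ) (RatFunc ℂ) d)⁻¹ •
        N.map (algebraMap (Polynomial ℂ) (RatFunc ℂ))) i j =
          algebraMap (Polynomial ℂ) (RatFunc ℂ) (W i j) /
            algebraMap (Polynomial ℂ) (RatFunc ℂ) e := fun i j => by
      rw [entry, hW, hd, map_mul, map_mul, mul_div_mul_left _ _ (RatFunc.algebraMap_ne_zero hX)]
    refine ⟨fun i j => ?_, ?_⟩
    · rw [entry']
      exact (eval_div_of_eval_ne_zero _ _ _ he).1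
    · have : (Matrix.of fun i j => RatFunc.eval (RingHom.id ℂ) x
          (((algebraMap (Polynomial ℂ) (RatFunc ℂ) d)⁻¹ •
            N.map (algebraMap (Polynomial ℂ) (RatFunc ℂ))) i j)) =
          (e.eval x)⁻¹ • (evalRingHom x).mapMatrix (Matrix.of W) := by
        ext i j
        rw [Matrix.of_apply, entry', (eval_div_of_eval_ne_zero _ _ _ he).2]
        simp [div_eq_inv_mul]
      rw [this, Matrix.det_smul, ← RingHom.map_det, hdetW]
      exact mul_ne_zero (pow_ne_zero _ (inv_ne_zero he)) hg

/-- If exactly one of the dilates of `p` vanishes at `x`, and `p` has a simple zero there, then the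
product of the dilates has a simple zero at `x`. -/
theorem prod_comp_C_mul_X_eq (p : Polynomial ℂ) (hp : p ≠ 0) (c : ℕ → ℂ) (n k : ℕ) (x : ℂ)
    (hk : k < n) (hck : c k ≠ 0) (hroot : rootMultiplicity (c k * x) p = 1)
    (hother : ∀ l, l ≠ k → ¬ p.IsRoot (c l * x)) :
    ∃ g : Polynomial ℂ, ∏ l ∈ Finset.range n, p.comp (C (c l) * X) = (X - C x) * g ∧
      g.eval x ≠ 0 := by
  obtain ⟨w, hw, hnd⟩ := exists_eq_pow_rootMultiplicity_mul_and_not_dvd p hp (c k * x)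
  rw [hroot, pow_one] at hw
  have hwx : w.eval (c k * x) ≠ 0 := fun h => hnd (dvd_iff_isRoot.2 h)
  refine ⟨C (c k) * w.comp (C (c k) * X) *
    ∏ l ∈ (Finset.range n).erase k, p.comp (C (c l) * X), ?_, ?_⟩
  · rw [← Finset.mul_prod_erase _ _ (Finset.mem_range.2 hk), ← mul_assoc]
    congr 1
    conv_lhs => rw [hw]
    simp only [mul_comp, sub_comp, X_comp, C_comp, map_mul]
    ring
  · simp only [eval_mul, eval_C, eval_comp, eval_X, eval_prod]
    refine mul_ne_zero (mul_ne_zero hck hwx) (Finset.prod_ne_zero_iff.2 fun l hl => ?_)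
    exact hother l (Finset.ne_of_mem_erase hl)

theorem zpow_mul_injective {q s : ℂ} (hq0 : q ≠ 0) (hq1 : ‖q‖ < 1) (hs : s ≠ 0) :
    Function.Injective fun m : ℤ => q ^ m * s := by
  intro m n h
  have h1 : q ^ m = q ^ n := mul_right_cancel₀ hs h
  have h2 : ‖q‖ ^ m = ‖q‖ ^ n := by rw [← norm_zpow, h1, norm_zpow]
  exact zpow_right_injective₀ (norm_pos_iff.2 hq0) hq1.ne h2

theorem eval_Delta (q : ℂ) (a0 a1 a2 : Polynomial ℂ) (r : ℕ) (s : ℂ) :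
    RatFunc.eval (RingHom.id ℂ) s (Delta q a0 a1 a2 r) =
      (tridiagonal (fun k => a0.eval (q ^ (-(k : ℤ)) * s)) (fun k => a1.eval (q ^ (-(k : ℤ)) * s))
        (fun k => a2.eval (q ^ (-(k : ℤ)) * s)) (r + 1)).det := by
  have h : Delta q a0 a1 a2 r = algebraMap (Polynomial ℂ) (RatFunc ℂ)
      (tridiagonal (fun k => a0.comp (C (q ^ (-(k : ℤ))) * X))
        (fun k => a1.comp (C (q ^ (-(k : ℤ))) * X))
        (fun k => a2.comp (C (q ^ (-(k : ℤ))) * X)) (r + 1)).det := by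
    rw [RingHom.map_det]
    unfold Delta
    congr 1
    ext i j
    simp only [tridiagonal, pshift, Matrix.of_apply, RingHom.mapMatrix_apply, Matrix.map_apply]
    split_ifs <;> simp
  rw [h, RatFunc.eval_algebraMap]
  simp only [Algebra.algebraMap_self, RingHom.id_apply, eval₂_id]
  rw [← coe_evalRingHom, RingHom.map_det]
  congr 1
  ext i j
  simp only [tridiagonal, Matrix.of_apply, RingHom.mapMatrix_apply, Matrix.map_apply]
  split_ifs <;> simp [eval_comp]

theorem isApparent_iff {n : ℕ} (q : ℂ) (A : Matrix (Fin n) (Fin n) (RatFunc ℂ)) (s : ℂ) :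
    IsApparent q A s ↔ ∃ N0 : ℕ, ∀ N N' : ℕ, N0 ≤ N → N0 ≤ N' →
      RegularAt (((List.range (N + N' + 1)).map fun k : ℕ =>
        A.map (qshift (q ^ ((N : ℤ) - (k : ℤ))))).prod) s := by
  have h : ∀ l : List ℕ, (do let a ← l; pure (a : ℤ)) = l.map fun a : ℕ => (a : ℤ) := fun l => by
    simp [← List.map_eq_flatMap]
  simp only [IsApparent, h, List.map_map, Function.comp_def]

/-- The product defining apparent singularities is regular at `q ^ (-m) * s`, `0 ≤ m ≤ r`, if and
only if `Delta` vanishes at `s`. -/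
theorem regularAt_prod_iff (q : ℂ) (hq0 : q ≠ 0) (hq1 : ‖q‖ < 1)
    (a0 a1 a2 : Polynomial ℂ) (ha0 : a0 ≠ 0) (ha2 : a2 ≠ 0) (s : ℂ) (hs : s ≠ 0) (r : ℕ)
    (hsimple0 : rootMultiplicity s a0 = 1)
    (hsimple2 : rootMultiplicity (q ^ (-(r : ℤ)) * s) a2 = 1)
    (hother0 : ∀ m : ℤ, a0.IsRoot (q ^ m * s) → q ^ m * s = s)
    (hother2 : ∀ m : ℤ, a2.IsRoot (q ^ m * s) → q ^ m * s = q ^ (-(r : ℤ)) * s)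
    (m N N' : ℕ) (hm : m ≤ r) (hN : r ≤ N) (hN' : r ≤ N') :
    RegularAt (((List.range (N + N' + 1)).map fun k : ℕ =>
      (Amat a0 a1 a2).map (qshift (q ^ ((N : ℤ) - (k : ℤ))))).prod) (q ^ (-(m : ℤ)) * s) ↔
      RatFunc.eval (RingHom.id ℂ) s (Delta q a0 a1 a2 r) = 0 := by
  have hc : ∀ k : ℕ, q ^ ((N : ℤ) - (k : ℤ)) ≠ 0 := fun k => zpow_ne_zero _ hq0
  have hmul : ∀ k : ℕ, q ^ ((N : ℤ) - (k : ℤ)) * (q ^ (-(m : ℤ)) * s) =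
      q ^ ((N : ℤ) - k - m) * s := fun k => by
    rw [← mul_assoc, ← zpow_add₀ hq0, sub_eq_add_neg _ (m : ℤ)]
  have hinj := zpow_mul_injective hq0 hq1 hs
  have hne0 : ∀ j : ℤ, j ≠ 0 → ¬ a0.IsRoot (q ^ j * s) := fun j hj h =>
    hj (hinj (by simpa using hother0 j h))
  have hne2 : ∀ j : ℤ, j ≠ -(r : ℤ) → ¬ a2.IsRoot (q ^ j * s) := fun j hj h =>
    hj (hinj (hother2 j h))
  have hz0 : a0.eval s = 0 :=
    (rootMultiplicity_pos ha0).1 (by omega)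
  have hz2 : a2.eval (q ^ (-(r : ℤ)) * s) = 0 :=
    (rootMultiplicity_pos ha2).1 (by omega)
  obtain ⟨g0, hg0, hg0'⟩ := prod_comp_C_mul_X_eq a0 ha0 (fun k => q ^ ((N : ℤ) - (k : ℤ)))
    (N + N' + 1) (N - m) (q ^ (-(m : ℤ)) * s) (by omega) (hc _)
    (by
      rw [hmul, show (N : ℤ) - ((N - m : ℕ) : ℤ) - m = 0 by omega]
      simpa using hsimple0)
    (fun l hl => by
      rw [hmul]
      exact hne0 _ (by omega))
  obtain ⟨g2, hg2, hg2'⟩ := prod_comp_C_mul_X_eq a2 ha2 (fun k => q ^ ((N : ℤ) - (k : ℤ)))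
    (N + N' + 1) (N - m + r) (q ^ (-(m : ℤ)) * s) (by omega) (hc _)
    (by
      rw [hmul, show (N : ℤ) - ((N - m + r : ℕ) : ℤ) - m = -(r : ℤ) by omega]
      exact hsimple2)
    (fun l hl => by
      rw [hmul]
      exact hne2 _ (by omega))
  rw [list_prod_Amat _ hc _ _ _ ha0, regularAt_inv_smul_iff _ _ g0 (g0 * g2) _ hg0 hg0'
    (by rw [det_list_prod_companionNum, hg0, hg2]; ring)
    (by rw [eval_mul]; exact mul_ne_zero hg0' hg2'), map_list_prod_companionNum]
  simp only [coe_evalRingHom, eval_comp, eval_mul, eval_C, eval_X, hmul]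
  have hunit : ∀ j : ℤ, j ≠ 0 → j ≠ -(r : ℤ) → IsUnit (companionNum (a0.eval (q ^ j * s))
      (a1.eval (q ^ j * s)) (a2.eval (q ^ j * s))) := fun j h0 h2 => by
    rw [Matrix.isUnit_iff_isUnit_det, det_companionNum, isUnit_iff_ne_zero]
    exact mul_ne_zero (hne0 j h0) (hne2 j h2)
  rw [show N + N' + 1 = (N - m) + (r + 1) + (N' + m - r) by omega,
    list_prod_eq_zero_iff_of_isUnit _ (N - m) (r + 1) (N' + m - r)
      (fun k hk => hunit _ (by omega) (by omega)) (fun k hk => hunit _ (by omega) (by omega))]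
  have hexp : ∀ k : ℕ, (N : ℤ) - ((N - m + k : ℕ) : ℤ) - m = -(k : ℤ) := fun k => by omega
  simp only [hexp]
  rw [eval_Delta]
  exact list_prod_companionNum_eq_zero_iff _ _ _ r (by simpa using hz0) hz2

/-- under the stated assumptions on the zeroes of `a_0` and `a_2`, the
points `s` and `q^{-r} s` are apparent singularities iff `Δ_r(s) = 0`. -/
theorem apparent_iff_Delta (q : ℂ) (hq0 : q ≠ 0) (hq1 : ‖q‖ < 1)
    (a0 a1 a2 : Polynomial ℂ) (ha0 : a0 ≠ 0) (ha2 : a2 ≠ 0)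
    (s : ℂ) (hs : s ≠ 0) (r : ℕ) (hr : 0 < r)
    (hsimple0 : rootMultiplicity s a0 = 1)
    (hsimple2 : rootMultiplicity (q ^ (-(r : ℤ)) * s) a2 = 1)
    (hother0 : ∀ m : ℤ, a0.IsRoot (q ^ m * s) → q ^ m * s = s)
    (hother2 : ∀ m : ℤ, a2.IsRoot (q ^ m * s) → q ^ m * s = q ^ (-(r : ℤ)) * s) :
    (IsApparent q (Amat a0 a1 a2) s ∧ IsApparent q (Amat a0 a1 a2) (q ^ (-(r : ℤ)) * s)) ↔
      RatFunc.eval (RingHom.id ℂ) s (Delta q a0 a1 a2 r) = 0 := by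
  have key := regularAt_prod_iff q hq0 hq1 a0 a1 a2 ha0 ha2 s hs r hsimple0 hsimple2 hother0 hother2
  rw [isApparent_iff, isApparent_iff]
  constructor
  · rintro ⟨⟨N0, h⟩, -⟩
    refine (key 0 (max N0 r) (max N0 r) (Nat.zero_le r) (le_max_right _ _) (le_max_right _ _)).1 ?_
    simpa using h (max N0 r) (max N0 r) (le_max_left _ _) (le_max_left _ _)
  · intro h
    refine ⟨⟨r, fun N N' hN hN' => ?_⟩, ⟨r, fun N N' hN hN' => ?_⟩⟩
    · simpa using (key 0 N N' (Nat.zero_le r) hN hN').2 h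
    · exact (key r N N' le_rfl hN hN').2 h

end
end

section
/- Let r ∈ ℤ_{≥0}, s ∈ ℂ^×, and for ε in a neighborhood of 0 let a_0(x,ε), a_1(x,ε), a_2(x,ε) be polynomials in x of uniformly bounded degree whose coefficients are analytic functions of ε at ε = 0, with 𝗊 = e^{−ε}. Assume: a_0(x,0) = a_2(x,0), a_1(x,0) = a_0(x,0) + a_2(x,0), ∂_ε a_1(x,ε)|_{ε=0} = ∂_ε(a_0 + a_2)(x,ε)|_{ε=0}; define α(x) = a_0(x,0), β(x) = ∂_ε(a_0 − a_2)(x,ε)|_{ε=0}, γ(x) = (1/2)∂_ε²(a_0 + a_2 − a_1)(x,ε)|_{ε=0}. Assume further that a_0(s,ε) = 0 and a_2(e^{rε}s, ε) = 0 identically in ε, and that α'(s) ≠ 0 (so α(s) = 0 and β(s) = r s α'(s)). Let Δ_r(s;ε) be the determinant of the (r+1)×(r+1) tridiagonal matrix whose row i (1 ≤ i ≤ r+1) has subdiagonal entry a_0(𝗊^{1−i}s, ε), diagonal entry a_1(𝗊^{1−i}s, ε), and superdiagonal entry a_2(𝗊^{1−i}s, ε). Then lim_{ε→0} ε^{−2r−2}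 Δ_r(s;ε) = det(−N), where N = (N_{i,j})_{0≤i,j≤r} with N_{i,j} = j(j−1)α_{i+2−j} − jβ_{i+1−j} + γ_{i−j}, and α_m, β_m, γ_m denote the Taylor coefficients at x = s of x²α(x), x(β(x) − α(x)), and γ(x) respectively (coefficients with negative index being 0). -/
open Polynomial

noncomputable section

/-- The tridiagonal determinant `Δ_r(s; ε)` with `𝗊 = e^{-ε}`: row `i` (0-based) has
subdiagonal entry `a_0(e^{iε} s, ε)`, diagonal entry `a_1(e^{iε} s, ε)` and
superdiagonal entry `a_2(e^{iε} s, ε)` (note `𝗊^{1-i} s = e^{(i-1)ε} s` 1-based). -/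
def DeltaE (r : ℕ) (s : ℂ) (a0 a1 a2 : ℂ → Polynomial ℂ) (ε : ℂ) : ℂ :=
  Matrix.det (Matrix.of fun i j : Fin (r + 1) =>
    if (i : ℕ) = (j : ℕ) + 1 then (a0 ε).eval (Complex.exp ((i : ℕ) * ε) * s)
    else if (i : ℕ) = (j : ℕ) then (a1 ε).eval (Complex.exp ((i : ℕ) * ε) * s)
    else if (j : ℕ) = (i : ℕ) + 1 then (a2 ε).eval (Complex.exp ((i : ℕ) * ε) * s)
    else 0)

/-- The Taylor coefficient of a polynomial at `s`, with the convention that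
coefficients of negative index vanish. -/
def tayCoeff (s : ℂ) (p : Polynomial ℂ) (m : ℤ) : ℂ :=
  if m < 0 then 0 else (Polynomial.taylor s p).coeff m.toNat

/-- The matrix `N = (N_{i,j})_{0≤i,j≤r}`,
`N_{i,j} = j(j−1)α_{i+2−j} − jβ_{i+1−j} + γ_{i−j}` where `α_m, β_m, γ_m` are the
Taylor coefficients at `s` of `x²α(x)`, `x(β(x)−α(x))`, `γ(x)`. -/
def Nmat (r : ℕ) (s : ℂ) (α β γ : Polynomial ℂ) : Matrix (Fin (r + 1)) (Fin (r + 1)) ℂ :=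
  Matrix.of fun i j =>
    ((j : ℕ) : ℂ) * (((j : ℕ) : ℂ) - 1) * tayCoeff s (X ^ 2 * α) (((i : ℕ) : ℤ) + 2 - (j : ℕ))
      - ((j : ℕ) : ℂ) * tayCoeff s (X * (β - α)) (((i : ℕ) : ℤ) + 1 - (j : ℕ))
      + tayCoeff s γ (((i : ℕ) : ℤ) - (j : ℕ))

open Filter Topology Matrix

/-- The `q`-difference operator `a₀ σ⁻¹ - a₁ + a₂ σ` acting on polynomials, `σ f(x) = f(q x)`. -/
def qDiffOp (a0 a1 a2 : ℂ[X]) (q : ℂ) (f : ℂ[X]) : ℂ[X] :=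
  a0 * f.comp (C q⁻¹ * X) - a1 * f + a2 * f.comp (C q * X)

/-- The differential operator `α (x d/dx)² - β (x d/dx) + γ` acting on polynomials. -/
def fuchsOp (α β γ f : ℂ[X]) : ℂ[X] :=
  α * (X * derivative (X * derivative f)) - β * (X * derivative f) + γ * f

lemma eval_qDiffOp (a0 a1 a2 : ℂ[X]) (q : ℂ) (f : ℂ[X]) (x : ℂ) :
    (qDiffOp a0 a1 a2 q f).eval x
      = a0.eval x * f.eval (q⁻¹ * x) - a1.eval x * f.eval x + a2.eval x * f.eval (q * x) := by
  simp [qDiffOp]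

lemma natDegree_qDiffOp_le {a0 a1 a2 : ℂ[X]} {d : ℕ} (h0 : a0.natDegree ≤ d)
    (h1 : a1.natDegree ≤ d) (h2 : a2.natDegree ≤ d) (q : ℂ) (f : ℂ[X]) :
    (qDiffOp a0 a1 a2 q f).natDegree ≤ d + f.natDegree := by
  have hcomp (c : ℂ) : (f.comp (C c * X)).natDegree ≤ f.natDegree :=
    natDegree_comp_le.trans <| by
      simpa using Nat.mul_le_mul_left f.natDegree ((natDegree_C_mul_le c X).trans natDegree_X_le)
  exact natDegree_add_le_of_degree_le
    (natDegree_sub_le_of_le (natDegree_mul_le_of_le h0 (hcomp _)) (natDegree_mul_le_of_le h1 le_rfl)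
      |>.trans (by simp)) (natDegree_mul_le_of_le h2 (hcomp _))

lemma tendsto_div_sq_of_deriv_eq_zero {f : ℂ → ℂ} (hf : AnalyticAt ℂ f 0) (h0 : f 0 = 0)
    (h1 : deriv f 0 = 0) :
    Tendsto (fun ε => (ε ^ 2)⁻¹ * f ε) (𝓝[≠] 0) (𝓝 (iteratedDeriv 2 f 0 / 2)) := by
  have hO := (hf.hasFPowerSeriesAt.isBigO_sub_partialSum_pow 3).mono (nhdsWithin_le_nhds (s := {0}ᶜ))
  have hO' : (fun ε => f ε - iteratedDeriv 2 f 0 / 2 * ε ^ 2) =o[𝓝[≠] 0] fun ε : ℂ => ε ^ 2 := by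
    refine (hO.congr (g₂ := fun ε : ℂ => ‖ε ^ 3‖) (fun ε => ?_) (fun ε => by simp)).of_norm_right
      |>.trans_isLittleO ?_
    · simp [FormalMultilinearSeries.partialSum, Finset.sum_range_succ, h0, h1,
        FormalMultilinearSeries.apply_eq_prod_smul_coeff, mul_comm]
    · exact (Asymptotics.isLittleO_pow_pow (𝕜 := ℂ) (show 2 < 3 by norm_num)).mono nhdsWithin_le_nhds
  have := hO'.tendsto_div_nhds_zero.add_const (iteratedDeriv 2 f 0 / 2)
  rw [zero_add] at this
  refine this.congr' ?_
  filter_upwards [self_mem_nhdsWithin] with ε (hε : ε ≠ 0)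
  field_simp
  ring

lemma hasDerivAt_eval_exp_mul (f : ℂ[X]) (x ε : ℂ) :
    HasDerivAt (fun ε => f.eval (Complex.exp ε * x))
      ((X * derivative f).eval (Complex.exp ε * x)) ε := by
  have := (f.hasDerivAt (Complex.exp ε * x)).comp ε ((Complex.hasDerivAt_exp ε).mul_const x)
  simpa [Function.comp_def, mul_comm, mul_left_comm] using this

lemma hasDerivAt_eval_exp_neg_mul (f : ℂ[X]) (x ε : ℂ) :
    HasDerivAt (fun ε => f.eval (Complex.exp (-ε) * x))
      (-(X * derivative f).eval (Complex.exp (-ε) * x)) ε := by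
  have := (hasDerivAt_eval_exp_mul f x (-ε)).comp ε (hasDerivAt_neg ε)
  simpa only [Function.comp_def, mul_neg_one] using this

lemma tendsto_eval_exp_second_difference (f : ℂ[X]) (x : ℂ) :
    Tendsto (fun ε => (ε ^ 2)⁻¹ * (f.eval (Complex.exp ε * x) + f.eval (Complex.exp (-ε) * x)
        - 2 * f.eval x)) (𝓝[≠] 0)
      (𝓝 ((X * derivative (X * derivative f)).eval x)) := by
  have hd : deriv (fun ε => f.eval (Complex.exp ε * x) + f.eval (Complex.exp (-ε) * x)
      - 2 * f.eval x) = fun ε => (X * derivative f).eval (Complex.exp ε * x)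
        + -(X * derivative f).eval (Complex.exp (-ε) * x) :=
    funext fun ε => (((hasDerivAt_eval_exp_mul f x ε).add
      (hasDerivAt_eval_exp_neg_mul f x ε)).sub_const _).deriv
  have hdiff : Differentiable ℂ fun ε => f.eval (Complex.exp ε * x)
      + f.eval (Complex.exp (-ε) * x) - 2 * f.eval x := fun ε =>
    (((hasDerivAt_eval_exp_mul f x ε).add
      (hasDerivAt_eval_exp_neg_mul f x ε)).sub_const _).differentiableAt
  convert tendsto_div_sq_of_deriv_eq_zero (hdiff.analyticAt 0) ?_ ?_ using 2
  · rw [iteratedDeriv_succ, iteratedDeriv_one, hd, ((hasDerivAt_eval_exp_mul (X * derivative f) x 0).fun_add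
      (hasDerivAt_eval_exp_neg_mul (X * derivative f) x 0).fun_neg).deriv]
    simp
  · simp; ring
  · rw [hd]; simp

lemma analyticAt_eval_of_coeff {a : ℂ → ℂ[X]} {d : ℕ} (hdeg : ∀ ε, (a ε).natDegree ≤ d)
    (h : ∀ k, AnalyticAt ℂ (fun ε => (a ε).coeff k) 0) (x : ℂ) :
    AnalyticAt ℂ (fun ε => (a ε).eval x) 0 := by
  simp_rw [fun ε => eval_eq_sum_range' (Nat.lt_succ_of_le (hdeg ε)) x]
  exact Finset.analyticAt_fun_sum _ fun k _ => (h k).mul analyticAt_const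

lemma tendsto_coeff_taylor_of_tendsto_eval {ι : Type*} {l : Filter ι} {P : ι → ℂ[X]} {Q : ℂ[X]}
    {M : ℕ} (hP : ∀ i, (P i).natDegree ≤ M) (h : ∀ x, Tendsto (fun i => (P i).eval x) l (𝓝 (Q.eval x)))
    (s : ℂ) (k : ℕ) :
    Tendsto (fun i => (taylor s (P i)).coeff k) l (𝓝 ((taylor s Q).coeff k)) := by
  set S := Finset.range (max M Q.natDegree + 1)
  have hinj : Set.InjOn (fun n : ℕ => (n : ℂ)) S := Nat.cast_injective.injOn
  have key (R : ℂ[X]) (hR : R.natDegree ≤ max M Q.natDegree) : (taylor s R).coeff k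
      = ∑ n ∈ S, R.eval (n : ℂ) * (taylor s (Lagrange.basis S (fun n : ℕ => (n : ℂ)) n)).coeff k := by
    have hdeg : R.degree < S.card := by
      rw [Finset.card_range]
      exact degree_le_natDegree.trans_lt (by exact_mod_cast Nat.lt_succ_of_le hR)
    conv_lhs => rw [Lagrange.eq_interpolate hinj hdeg]
    simp [Lagrange.interpolate_apply, taylor_mul, finsetSum_coeff]
  rw [key Q (le_max_right _ _)]
  simp_rw [fun i => key (P i) ((hP i).trans (le_max_left _ _))]
  exact tendsto_finsetSum _ fun n _ => (h n).mul_const _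

lemma coeff_taylor_fuchsOp (r : ℕ) (s : ℂ) (α β γ : ℂ[X]) (i j : Fin (r + 1)) :
    (taylor s (fuchsOp α β γ ((X - C s) ^ (j : ℕ)))).coeff i = Nmat r s α β γ i j := by
  obtain ⟨i, hi⟩ := i
  obtain ⟨j, hj⟩ := j
  have hX : taylor s ((X - C s) ^ j) = X ^ j := by simp [taylor_apply]
  have h0 : (taylor s (γ * (X - C s) ^ j)).coeff i = tayCoeff s γ ((i : ℤ) - j) := by
    rw [taylor_mul, hX, coeff_mul_X_pow', tayCoeff]
    split_ifs <;> first | omega | rfl | (congr 1; omega)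
  have h1 : (taylor s (X * (β - α) * (C (j : ℂ) * (X - C s) ^ (j - 1)))).coeff i
      = j * tayCoeff s (X * (β - α)) ((i : ℤ) + 1 - j) := by
    rcases j with _ | j
    · simp
    have hX : taylor s ((X - C s) ^ j) = X ^ j := by simp [taylor_apply]
    rw [mul_left_comm, taylor_mul _ (C _), taylor_C, coeff_C_mul, taylor_mul, Nat.add_sub_cancel, hX,
      coeff_mul_X_pow', tayCoeff]
    congr 1
    split_ifs <;> first | omega | rfl | (congr 1; omega)
  have h2 : (taylor s (X ^ 2 * α * (C (j * (j - 1) : ℂ) * (X - C s) ^ (j - 2)))).coeff i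
      = j * (j - 1) * tayCoeff s (X ^ 2 * α) ((i : ℤ) + 2 - j) := by
    rcases j with _ | _ | j
    · simp
    · simp
    have hX : taylor s ((X - C s) ^ j) = X ^ j := by simp [taylor_apply]
    rw [mul_left_comm, taylor_mul _ (C _), taylor_C, coeff_C_mul, taylor_mul,
      show j + 1 + 1 - 2 = j by omega, hX, coeff_mul_X_pow', tayCoeff]
    congr 1
    split_ifs <;> first | omega | rfl | (congr 1; omega)
  have hd1 : derivative ((X - C s) ^ j) = C (j : ℂ) * (X - C s) ^ (j - 1) :=
    derivative_X_sub_C_pow s j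
  have hd2 : derivative (derivative ((X - C s) ^ j))
      = C (j * (j - 1) : ℂ) * (X - C s) ^ (j - 2) := by
    rcases j with _ | j
    · simp
    · rw [hd1, derivative_C_mul, derivative_X_sub_C_pow]
      simp [mul_assoc]
  have : fuchsOp α β γ ((X - C s) ^ j)
      = X ^ 2 * α * (C (j * (j - 1) : ℂ) * (X - C s) ^ (j - 2))
        - X * (β - α) * (C (j : ℂ) * (X - C s) ^ (j - 1)) + γ * (X - C s) ^ j := by
    rw [← hd2, ← hd1, fuchsOp, derivative_mul, derivative_X]
    ring
  simp only [this, map_add, map_sub, coeff_add, coeff_sub, h0, h1, h2, Nmat, Matrix.of_apply]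

lemma tendsto_eval_qDiffOp {a0 a1 a2 : ℂ → ℂ[X]} {β γ : ℂ[X]}
    (hA0 : ∀ x, AnalyticAt ℂ (fun ε => (a0 ε).eval x) 0)
    (hA1 : ∀ x, AnalyticAt ℂ (fun ε => (a1 ε).eval x) 0)
    (hA2 : ∀ x, AnalyticAt ℂ (fun ε => (a2 ε).eval x) 0)
    (h00 : a0 0 = a2 0)
    (h01 : a1 0 = a0 0 + a2 0)
    (h11 : ∀ x : ℂ, deriv (fun ε => (a1 ε).eval x) 0
      = deriv (fun ε => (a0 ε).eval x + (a2 ε).eval x) 0)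
    (hβ : ∀ x : ℂ, β.eval x = deriv (fun ε => (a0 ε).eval x - (a2 ε).eval x) 0)
    (hγ : ∀ x : ℂ, γ.eval x
      = (1 / 2) * iteratedDeriv 2 (fun ε => (a0 ε).eval x + (a2 ε).eval x - (a1 ε).eval x) 0)
    (f : ℂ[X]) (x : ℂ) :
    Tendsto (fun ε => (ε ^ 2)⁻¹ *
        (qDiffOp (a0 ε) (a1 ε) (a2 ε) (Complex.exp ε) f).eval x) (𝓝[≠] 0)
      (𝓝 ((fuchsOp (a0 0) β γ f).eval x)) := by
  have t1 : Tendsto (fun ε => (ε ^ 2)⁻¹ * ((a0 ε).eval x + (a2 ε).eval x - (a1 ε).eval x))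
      (𝓝[≠] 0) (𝓝 (γ.eval x)) := by
    rw [hγ, one_div_mul_eq_div]
    refine tendsto_div_sq_of_deriv_eq_zero (((hA0 x).add (hA2 x)).sub (hA1 x)) (by simp [h01]) ?_
    have := ((hA0 x).add (hA2 x)).differentiableAt.hasDerivAt.sub
      (hA1 x).differentiableAt.hasDerivAt
    rw [h11] at this
    exact this.deriv.trans (sub_self _)
  have t2 : Tendsto (fun ε => ε⁻¹ * ((a0 ε).eval x - (a2 ε).eval x)) (𝓝[≠] 0)
      (𝓝 (β.eval x)) := by
    have := hasDerivAt_iff_tendsto_slope_zero.1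
      ((hA0 x).sub (hA2 x)).differentiableAt.hasDerivAt
    rw [hβ x]
    simpa [h00, Pi.sub_def] using this
  have t3 : Tendsto (fun ε => ε⁻¹ * (f.eval (Complex.exp (-ε) * x) - f.eval x)) (𝓝[≠] 0)
      (𝓝 (-(X * derivative f).eval x)) := by
    simpa using hasDerivAt_iff_tendsto_slope_zero.1 (hasDerivAt_eval_exp_neg_mul f x 0)
  have t4 := tendsto_eval_exp_second_difference f x
  have t5 : Tendsto (fun ε => (a2 ε).eval x) (𝓝[≠] 0) (𝓝 ((a0 0).eval x)) := by
    rw [h00]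
    exact (hA2 x).continuousAt.tendsto.mono_left nhdsWithin_le_nhds
  convert ((t1.mul_const (f.eval x)).add (t2.mul t3)).add (t5.mul t4) using 2 with ε
  · rw [eval_qDiffOp, ← Complex.exp_neg]
    ring
  · simp only [fuchsOp, eval_add, eval_sub, eval_mul]
    ring

lemma sum_fin_tridiagonal {r : ℕ} {i : ℕ} (hi : i < r + 1) (u v w : ℂ) (g : ℤ → ℂ)
    (hu : i = 0 → u = 0) (hw : i = r → w = 0) :
    ∑ k : Fin (r + 1), (if i = (k : ℕ) + 1 then u else if i = (k : ℕ) then v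
      else if (k : ℕ) = i + 1 then w else 0) * g (k : ℕ)
      = u * g (i - 1) + v * g i + w * g (i + 1) := by
  have hsplit (k : ℕ) : (if i = k + 1 then u else if i = k then v
      else if k = i + 1 then w else 0) * g k
      = (if i = k + 1 then u * g (i - 1) else 0) + (if i = k then v * g i else 0)
        + (if k = i + 1 then w * g (i + 1) else 0) := by
    rcases eq_or_ne i (k + 1) with rfl | h1
    · simp [show k ≠ k + 1 + 1 by omega]
    rcases eq_or_ne i k with rfl | h2
    · simp
    rcases eq_or_ne k (i + 1) with rfl | h3
    · simp [show i ≠ i + 1 + 1 by omega]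
    · simp [h1, h2, h3]
  rw [Fin.sum_univ_eq_sum_range (fun k => (if i = k + 1 then u else if i = k then v
      else if k = i + 1 then w else 0) * g (k : ℕ)) (r + 1)]
  simp_rw [hsplit, Finset.sum_add_distrib]
  congr 1
  · congr 1
    · rcases i with _ | i
      · simp [hu rfl]
      · simp [Finset.sum_ite_eq, show i < r + 1 by omega]
    · simp [hi]
  · rcases eq_or_ne i r with h | h
    · simp [hw h]
    · simp [show i < r by omega]

lemma eval_eq_sum_taylor_add_tail {P : ℂ[X]} {n m : ℕ} (hP : P.natDegree < n + m) {s x ε t : ℂ}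
    (hx : x - s = ε * t) :
    P.eval x = ∑ k : Fin n, (x - s) ^ (k : ℕ) * (taylor s P).coeff k
      + ε ^ n * ∑ l ∈ Finset.range m, (taylor s P).coeff (n + l) * ε ^ l * t ^ (n + l) := by
  rw [← natDegree_taylor P s] at hP
  rw [← taylor_eval_sub s, eval_eq_sum_range' hP, Finset.sum_range_add,
    Fin.sum_univ_eq_sum_range (fun k => (x - s) ^ k * (taylor s P).coeff k), Finset.mul_sum]
  congr 1
  · exact Finset.sum_congr rfl fun k _ => mul_comm _ _
  · refine Finset.sum_congr rfl fun l _ => ?_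
    rw [hx]
    ring

lemma det_eq_of_mul_diagonal_mul_eq {n : Type*} [Fintype n] [DecidableEq n]
    {A B V : Matrix n n ℂ} {σ : n → ℂ} (hσ : ∀ i, σ i ≠ 0) (hV : V.det ≠ 0)
    (h : A * (diagonal σ * V) = diagonal σ * (V * B)) : A.det = B.det := by
  have hdet := congrArg Matrix.det h
  simp only [det_mul, det_diagonal] at hdet
  have hσ' : ∏ i, σ i ≠ 0 := Finset.prod_ne_zero_iff.2 fun i _ => hσ i
  refine mul_right_cancel₀ (mul_ne_zero hσ' hV) ?_
  rw [hdet]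
  ring

/-- Writing `x i - s = ε * t i`, evaluation at the nodes of polynomials of degree `< r + 1 + m`
factors through the Vandermonde matrix of the `x i - s`, the second factor being the matrix of
Taylor coefficients up to a correction of order `ε`. -/
lemma vandermonde_mul_taylor_coeff_add {r m : ℕ} {s ε : ℂ} {x t : Fin (r + 1) → ℂ}
    (hx : ∀ i, x i - s = ε * t i) (ht : IsUnit (vandermonde t).det)
    {P : Fin (r + 1) → ℂ[X]} (hP : ∀ j, (P j).natDegree < r + 1 + m) :
    vandermonde (fun i => x i - s) * (Matrix.of (fun i j : Fin (r + 1) => (taylor s (P j)).coeff i)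
        + ε • (diagonal (fun k : Fin (r + 1) => ε ^ (r - k)) * ((vandermonde t)⁻¹ *
          Matrix.of fun i j : Fin (r + 1) => ∑ l ∈ Finset.range m,
            (taylor s (P j)).coeff (r + 1 + l) * ε ^ l * t i ^ (r + 1 + l))))
      = Matrix.of fun i j => (P j).eval (x i) := by
  have hV : vandermonde (fun i => x i - s)
      = vandermonde t * diagonal (fun k : Fin (r + 1) => ε ^ (k : ℕ)) := by
    ext i j
    simp [vandermonde_apply, hx, mul_pow, mul_comm]
  have hE : diagonal (fun k : Fin (r + 1) => ε ^ (k : ℕ)) *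
      ε • diagonal (fun k : Fin (r + 1) => ε ^ (r - k)) = ε ^ (r + 1) • 1 := by
    rw [Matrix.mul_smul, diagonal_mul_diagonal, ← diagonal_one, ← diagonal_smul, ← diagonal_smul]
    congr 1
    ext k
    have := k.is_lt
    simp only [Pi.smul_apply, smul_eq_mul, ← pow_add, mul_one]
    rw [← pow_succ']
    congr 1
    omega
  have hcorr (R : Matrix (Fin (r + 1)) (Fin (r + 1)) ℂ) :
      vandermonde (fun i => x i - s) * ε • (diagonal (fun k : Fin (r + 1) => ε ^ (r - k)) *
        ((vandermonde t)⁻¹ * R)) = ε ^ (r + 1) • R := by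
    rw [hV, Matrix.mul_assoc, ← Matrix.smul_mul, ← Matrix.mul_assoc (diagonal _), hE,
      Matrix.smul_mul, Matrix.one_mul, Matrix.mul_smul, mul_nonsing_inv_cancel_left _ _ ht]
  rw [mul_add, hcorr]
  ext i j
  simp [eval_eq_sum_taylor_add_tail (hP j) (hx i), Matrix.mul_apply, vandermonde_apply]

/-- The tridiagonal matrix, conjugated by alternating signs, represents `-(a₀ σ⁻¹ - a₁ + a₂ σ)`
on the values of a function at the nodes `q ^ i s`. -/
lemma tridiagonal_mul_sign_mul_vandermonde {r : ℕ} {s ε : ℂ} {a0 a1 a2 : ℂ[X]}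
    (hz0 : a0.eval s = 0) (hz2 : a2.eval (Complex.exp ((r : ℂ) * ε) * s) = 0) :
    (Matrix.of fun i j : Fin (r + 1) =>
      if (i : ℕ) = (j : ℕ) + 1 then a0.eval (Complex.exp ((i : ℕ) * ε) * s)
      else if (i : ℕ) = (j : ℕ) then a1.eval (Complex.exp ((i : ℕ) * ε) * s)
      else if (j : ℕ) = (i : ℕ) + 1 then a2.eval (Complex.exp ((i : ℕ) * ε) * s)
      else 0) * (diagonal (fun i : Fin (r + 1) => (-1 : ℂ) ^ (i : ℕ)) *
        vandermonde fun i : Fin (r + 1) => Complex.exp ((i : ℕ) * ε) * s - s)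
      = diagonal (fun i : Fin (r + 1) => (-1 : ℂ) ^ (i : ℕ)) *
        -(Matrix.of fun i j : Fin (r + 1) => (qDiffOp a0 a1 a2 (Complex.exp ε)
          ((X - C s) ^ (j : ℕ))).eval (Complex.exp ((i : ℕ) * ε) * s)) := by
  ext i j
  have h := sum_fin_tridiagonal i.is_lt (a0.eval (Complex.exp ((i : ℕ) * ε) * s))
    (a1.eval (Complex.exp ((i : ℕ) * ε) * s)) (a2.eval (Complex.exp ((i : ℕ) * ε) * s))
    (fun k : ℤ => (-1 : ℂ) ^ k * (Complex.exp (k * ε) * s - s) ^ (j : ℕ))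
    (fun h => by simp [h, hz0]) (fun h => by rw [h, hz2])
  have hneg : (-1 : ℂ) ≠ 0 := by norm_num
  have e1 : Complex.exp (((i : ℕ) - 1 : ℂ) * ε) = (Complex.exp ε)⁻¹ * Complex.exp ((i : ℕ) * ε) := by
    rw [← Complex.exp_neg, ← Complex.exp_add]
    ring_nf
  have e2 : Complex.exp (((i : ℕ) + 1 : ℂ) * ε) = Complex.exp ε * Complex.exp ((i : ℕ) * ε) := by
    rw [← Complex.exp_add]
    ring_nf
  simp only [Int.cast_natCast, zpow_natCast, Int.cast_sub, Int.cast_add, Int.cast_one, e1, e2,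
    zpow_sub_one₀ hneg, zpow_add_one₀ hneg] at h
  simp only [Matrix.mul_apply (M := Matrix.of _), Matrix.of_apply, diagonal_mul, vandermonde_apply,
    Matrix.neg_apply, eval_qDiffOp, eval_pow, eval_sub, eval_X, eval_C]
  rw [h]
  norm_num
  ring

lemma tendsto_matrix_inv {ι n : Type*} [Fintype n] [DecidableEq n] {l : Filter ι}
    {T : ι → Matrix n n ℂ} {T₀ : Matrix n n ℂ} (hT : Tendsto T l (𝓝 T₀)) (h : T₀.det ≠ 0) :
    Tendsto (fun i => (T i)⁻¹) l (𝓝 T₀⁻¹) :=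
  (continuousAt_matrix_inv T₀ (by
    rw [Ring.inverse_eq_inv']
    exact continuousAt_inv₀ h)).tendsto.comp hT

/-- Proposition A.1: `lim_{ε→0} ε^{−2r−2} Δ_r(s;ε) = det(−N)`. -/
theorem limit_Delta_eq_det_neg_N (r : ℕ) (s : ℂ) (hs : s ≠ 0)
    (a0 a1 a2 : ℂ → Polynomial ℂ) (d : ℕ)
    (hdeg : ∀ ε : ℂ, (a0 ε).natDegree ≤ d ∧ (a1 ε).natDegree ≤ d ∧ (a2 ε).natDegree ≤ d)
    (hanal : ∀ k : ℕ, AnalyticAt ℂ (fun ε => (a0 ε).coeff k) 0 ∧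
      AnalyticAt ℂ (fun ε => (a1 ε).coeff k) 0 ∧ AnalyticAt ℂ (fun ε => (a2 ε).coeff k) 0)
    -- expansion conditions: a0 − a2 = O(ε), a0 + a2 − a1 = O(ε²)
    (h00 : a0 0 = a2 0)
    (h01 : a1 0 = a0 0 + a2 0)
    (h11 : ∀ x : ℂ, deriv (fun ε => (a1 ε).eval x) 0
      = deriv (fun ε => (a0 ε).eval x + (a2 ε).eval x) 0)
    (β γ : Polynomial ℂ)
    (hβ : ∀ x : ℂ, β.eval x = deriv (fun ε => (a0 ε).eval x - (a2 ε).eval x) 0)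
    (hγ : ∀ x : ℂ, γ.eval x
      = (1 / 2) * iteratedDeriv 2 (fun ε => (a0 ε).eval x + (a2 ε).eval x - (a1 ε).eval x) 0)
    -- a_0(x,ε) vanishes at x = s and a_2(x,ε) vanishes at x = 𝗊^{-r} s = e^{rε} s,
    -- identically in ε
    (hz0 : ∀ ε : ℂ, (a0 ε).eval s = 0)
    (hz2 : ∀ ε : ℂ, (a2 ε).eval (Complex.exp ((r : ℂ) * ε) * s) = 0)
    (hα' : ((a0 0).derivative).eval s ≠ 0) :
    Filter.Tendsto (fun ε : ℂ => (ε ^ (2 * r + 2))⁻¹ * DeltaE r s a0 a1 a2 ε)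
      (nhdsWithin 0 {0}ᶜ)
      (nhds (Matrix.det (-(Nmat r s (a0 0) β γ)))) := by
  have hdeg0 ε := (hdeg ε).1
  have hdeg1 ε := (hdeg ε).2.1
  have hdeg2 ε := (hdeg ε).2.2
  set P : ℂ → Fin (r + 1) → ℂ[X] := fun ε j =>
    C (ε ^ 2)⁻¹ * qDiffOp (a0 ε) (a1 ε) (a2 ε) (Complex.exp ε) ((X - C s) ^ (j : ℕ)) with hPdef
  have hPdeg (ε : ℂ) (j : Fin (r + 1)) : (P ε j).natDegree ≤ d + r := by
    refine (natDegree_C_mul_le _ _).trans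
      ((natDegree_qDiffOp_le (hdeg0 ε) (hdeg1 ε) (hdeg2 ε) _ _).trans ?_)
    rw [natDegree_pow, natDegree_X_sub_C]
    omega
  have hcoeff (j : Fin (r + 1)) (k : ℕ) := tendsto_coeff_taylor_of_tendsto_eval
    (P := fun ε => P ε j) (Q := fuchsOp (a0 0) β γ ((X - C s) ^ (j : ℕ))) (l := 𝓝[≠] 0)
    (fun ε => hPdeg ε j) (fun x => by
      simpa [hPdef] using tendsto_eval_qDiffOp
        (analyticAt_eval_of_coeff hdeg0 fun k => (hanal k).1)
        (analyticAt_eval_of_coeff hdeg1 fun k => (hanal k).2.1)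
        (analyticAt_eval_of_coeff hdeg2 fun k => (hanal k).2.2) h00 h01 h11 hβ hγ _ x) s k
  set t : ℂ → Fin (r + 1) → ℂ := fun ε i => ε⁻¹ * (Complex.exp ((i : ℕ) * ε) * s - s) with htdef
  have ht (i : Fin (r + 1)) : Tendsto (fun ε => t ε i) (𝓝[≠] 0) (𝓝 ((i : ℕ) * s)) := by
    have := ((((hasDerivAt_id (0 : ℂ)).const_mul ((i : ℕ) : ℂ)).cexp).mul_const s)
    simpa [htdef] using hasDerivAt_iff_tendsto_slope_zero.1 this
  have hT : Tendsto (fun ε => vandermonde (t ε)) (𝓝[≠] 0)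
      (𝓝 (vandermonde fun i : Fin (r + 1) => ((i : ℕ) * s : ℂ))) :=
    tendsto_pi_nhds.2 fun i => tendsto_pi_nhds.2 fun j => (ht i).pow j
  have hT0 : (vandermonde fun i : Fin (r + 1) => ((i : ℕ) * s : ℂ)).det ≠ 0 :=
    det_vandermonde_ne_zero_iff.2 fun i j h => by
      simpa [hs, Fin.val_inj] using h
  have hdetT : ∀ᶠ ε in 𝓝[≠] (0 : ℂ), (vandermonde (t ε)).det ≠ 0 :=
    ((Continuous.matrix_det continuous_id).tendsto _ |>.comp hT).eventually_ne hT0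
  have hε : Tendsto (fun ε : ℂ => ε) (𝓝[≠] 0) (𝓝 0) := tendsto_id.mono_left nhdsWithin_le_nhds
  set R : ℂ → Matrix (Fin (r + 1)) (Fin (r + 1)) ℂ := fun ε => Matrix.of fun i j =>
    ∑ l ∈ Finset.range d, (taylor s (P ε j)).coeff (r + 1 + l) * ε ^ l * t ε i ^ (r + 1 + l)
    with hRdef
  have hR : Tendsto R (𝓝[≠] 0) (𝓝 (Matrix.of fun i j => ∑ l ∈ Finset.range d,
      (taylor s (fuchsOp (a0 0) β γ ((X - C s) ^ (j : ℕ)))).coeff (r + 1 + l) * 0 ^ l *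
        ((i : ℕ) * s : ℂ) ^ (r + 1 + l))) :=
    tendsto_pi_nhds.2 fun i => tendsto_pi_nhds.2 fun j => by
      simp only [hRdef, Matrix.of_apply]
      exact tendsto_finsetSum _ fun l _ =>
        ((hcoeff j (r + 1 + l)).mul (hε.pow l)).mul ((ht i).pow (r + 1 + l))
  have hN : Tendsto (fun ε => Matrix.of fun i j : Fin (r + 1) => (taylor s (P ε j)).coeff i)
      (𝓝[≠] 0) (𝓝 (Nmat r s (a0 0) β γ)) :=
    tendsto_pi_nhds.2 fun i => tendsto_pi_nhds.2 fun j => by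
      simpa only [coeff_taylor_fuchsOp, Matrix.of_apply] using hcoeff j i
  have hE : Tendsto (fun ε : ℂ => diagonal fun k : Fin (r + 1) => ε ^ (r - k)) (𝓝[≠] 0)
      (𝓝 (diagonal fun k : Fin (r + 1) => (0 : ℂ) ^ (r - k))) :=
    (Continuous.matrix_diagonal (by fun_prop)).tendsto (0 : ℂ) |>.mono_left nhdsWithin_le_nhds
  have hmul {A B : ℂ → Matrix (Fin (r + 1)) (Fin (r + 1)) ℂ} {A₀ B₀}
      (hA : Tendsto A (𝓝[≠] 0) (𝓝 A₀)) (hB : Tendsto B (𝓝[≠] 0) (𝓝 B₀)) :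
      Tendsto (fun ε => A ε * B ε) (𝓝[≠] 0) (𝓝 (A₀ * B₀)) := hA.mul hB
  have hK := hN.add (hε.smul (hmul hE (hmul (tendsto_matrix_inv hT hT0) hR)))
  rw [zero_smul, add_zero] at hK
  refine (((Continuous.matrix_det continuous_id).tendsto _).comp hK.neg).congr' ?_
  filter_upwards [hdetT, self_mem_nhdsWithin] with ε hTε (hε0 : ε ≠ 0)
  have hx (i : Fin (r + 1)) : Complex.exp ((i : ℕ) * ε) * s - s = ε * t ε i := by
    simp [htdef, hε0]
  have hV : (vandermonde fun i : Fin (r + 1) => Complex.exp ((i : ℕ) * ε) * s - s).det ≠ 0 := by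
    rw [det_vandermonde_ne_zero_iff] at hTε ⊢
    intro i j h
    exact hTε (by simpa [hx, hε0] using h)
  have hfac := vandermonde_mul_taylor_coeff_add hx hTε.isUnit (m := d)
    (P := P ε) (fun j => (hPdeg ε j).trans_lt (by omega))
  rw [DeltaE, det_eq_of_mul_diagonal_mul_eq (B := ε ^ 2 • -(Matrix.of (fun i j : Fin (r + 1) =>
    (taylor s (P ε j)).coeff i) + ε • (diagonal (fun k : Fin (r + 1) => ε ^ (r - k)) *
      ((vandermonde (t ε))⁻¹ * R ε)))) (fun i => pow_ne_zero _ (by norm_num)) hV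
    ((tridiagonal_mul_sign_mul_vandermonde (hz0 ε) (hz2 ε)).trans ?_)]
  · rw [det_smul, Fintype.card_fin, ← pow_mul, show 2 * (r + 1) = 2 * r + 2 by ring,
      inv_mul_cancel_left₀ (pow_ne_zero _ hε0)]
    rfl
  · rw [Matrix.mul_smul, mul_neg (vandermonde _), hfac, smul_neg]
    congr 2
    ext i j
    simp [hPdef, hε0]

end
end

section
/- Let f be a complex polynomial, s ∈ ℂ^×, and let i, j be integers with 0 ≤ j ≤ i. Then, as ε → 0 in ℂ, ∑_{k=0}^{i} (−1)^{i−k} C(i,k) C(k,j) f(e^{kε}s) − C(i,j) ε^{i−j} (D^{i−j}f)(s) = O(ε^{i−j+1}), where C(·,·) denotes binomial coefficients and D is the Euler operator (Df)(x) = x f'(x). -/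
open Polynomial

noncomputable section

/-- The Euler operator `D = x d/dx` on polynomials. -/
def eulerOp (p : Polynomial ℂ) : Polynomial ℂ := X * derivative p

open Asymptotics Filter Topology in
lemma exp_const_mul_sub_one_sub_isBigO (c : ℂ) :
    (fun ε : ℂ => Complex.exp (c * ε) - 1 - c * ε) =O[𝓝 0] fun ε => ε ^ 2 := by
  have base : (fun x : ℂ => Complex.exp x - 1 - x) =O[𝓝 0] fun x => x ^ 2 := by
    refine IsBigO.of_bound 1 ?_
    filter_upwards [Metric.closedBall_mem_nhds (0 : ℂ) one_pos] with x hx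
    rw [one_mul, norm_pow]
    exact Complex.norm_exp_sub_one_sub_id_le (by simpa using hx)
  have ht : Tendsto (fun ε : ℂ => c * ε) (𝓝 0) (𝓝 0) := by
    simpa using (continuous_const_mul c).tendsto (0 : ℂ)
  refine (base.comp_tendsto ht).trans ?_
  refine IsBigO.of_bound (‖c‖ ^ 2) (Eventually.of_forall fun ε => ?_)
  simp [mul_pow]

open Asymptotics Filter Topology in
lemma exp_const_mul_sub_one_isBigO (c : ℂ) :
    (fun ε : ℂ => Complex.exp (c * ε) - 1) =O[𝓝 0] fun ε => ε := by
  have h : (fun ε : ℂ => ε ^ 2) =O[𝓝 0] fun ε => ε := by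
    simpa using (IsLittleO.isBigO (isLittleO_pow_pow (𝕜 := ℂ) one_lt_two))
  have := ((exp_const_mul_sub_one_sub_isBigO c).trans h).add
    ((isBigO_refl (fun ε : ℂ => ε) (𝓝 0)).const_mul_left c)
  simpa using this

open Asymptotics Topology in
lemma exp_sub_one_pow_sub_isBigO (c : ℂ) (n : ℕ) :
    (fun ε : ℂ => (Complex.exp (c * ε) - 1) ^ n - (c * ε) ^ n)
      =O[𝓝 0] fun ε => ε ^ (n + 1) := by
  induction n with
  | zero => simpa using isBigO_zero _ _
  | succ n ih =>
    have h₁ := (exp_const_mul_sub_one_sub_isBigO c).mul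
      ((exp_const_mul_sub_one_isBigO c).pow n)
    have h₂ := ((isBigO_refl (fun ε : ℂ => ε) (𝓝 0)).const_mul_left c).mul ih
    refine ((h₁.congr_right fun ε => ?_).add (h₂.congr_right fun ε => ?_)).congr_left
      (g := fun ε : ℂ => ε ^ (n + 1 + 1)) fun ε => ?_
    all_goals ring

open Asymptotics Topology in
lemma exp_mul_exp_sub_one_pow_sub_isBigO (b c : ℂ) (n : ℕ) :
    (fun ε : ℂ => Complex.exp (b * ε) * (Complex.exp (c * ε) - 1) ^ n - (c * ε) ^ n)
      =O[𝓝 0] fun ε => ε ^ (n + 1) := by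
  have h₁ := (exp_const_mul_sub_one_isBigO b).mul ((exp_const_mul_sub_one_isBigO c).pow n)
  refine ((h₁.congr_right fun ε => ?_).add (exp_sub_one_pow_sub_isBigO c n)).congr_left
      (g := fun ε : ℂ => ε ^ (n + 1)) fun ε => ?_
  all_goals ring

lemma sum_choose_mul_choose_mul_pow {R : Type*} [CommRing R] (z : R) {i j : ℕ} (hij : j ≤ i) :
    ∑ k ∈ Finset.range (i + 1), (-1 : R) ^ (i - k) * (i.choose k : R) * (k.choose j : R) * z ^ k
      = (i.choose j : R) * (z ^ j * (z - 1) ^ (i - j)) := by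
  obtain ⟨n, rfl⟩ := Nat.exists_eq_add_of_le hij
  rw [add_assoc, Finset.sum_range_add, Finset.sum_eq_zero, zero_add, Nat.add_sub_cancel_left,
    sub_eq_add_neg, add_pow, Finset.mul_sum, Finset.mul_sum]
  · refine Finset.sum_congr rfl fun l hl => ?_
    have hl' : l ≤ n := Nat.lt_succ_iff.mp (Finset.mem_range.mp hl)
    have h := Nat.choose_mul (n := j + n) (k := j + l) (s := j) (by omega)
    simp only [Nat.add_sub_cancel_left] at h
    have h' : ((j + n).choose (j + l) : R) * ((j + l).choose j : R)
        = ((j + n).choose j : R) * (n.choose l : R) := by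
      exact_mod_cast congrArg (Nat.cast (R := R)) h
    rw [Nat.add_sub_add_left, pow_add]
    linear_combination (-1 : R) ^ (n - l) * z ^ j * z ^ l * h'
  · intro k hk
    simp [Nat.choose_eq_zero_of_lt (Finset.mem_range.mp hk)]

lemma eulerOp_iterate_add (n : ℕ) (p q : Polynomial ℂ) :
    eulerOp^[n] (p + q) = eulerOp^[n] p + eulerOp^[n] q := by
  induction n generalizing p q with
  | zero => rfl
  | succ n ih =>
    rw [Function.iterate_succ_apply, Function.iterate_succ_apply, Function.iterate_succ_apply,
      ← ih]
    simp [eulerOp, mul_add]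

lemma eulerOp_iterate_monomial (n m : ℕ) (a : ℂ) :
    eulerOp^[n] (monomial m a) = monomial m ((m : ℂ) ^ n * a) := by
  induction n with
  | zero => simp
  | succ n ih =>
    rw [Function.iterate_succ_apply', ih, eulerOp, derivative_monomial, X_mul_monomial]
    cases m with
    | zero => simp
    | succ m =>
      rw [Nat.add_sub_cancel]
      congr 1
      ring

/-- the asymptotic identity
`∑_{k=0}^{i} (−1)^{i−k} C(i,k) C(k,j) f(e^{kε}s) − C(i,j) ε^{i−j} (D^{i−j}f)(s) = O(ε^{i−j+1})`
as `ε → 0`. -/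
theorem binomial_euler_asymptotics (f : Polynomial ℂ) (s : ℂ) (hs : s ≠ 0)
    (i j : ℕ) (hij : j ≤ i) :
    (fun ε : ℂ =>
        (∑ k ∈ Finset.range (i + 1),
          (-1 : ℂ) ^ (i - k) * (i.choose k : ℂ) * (k.choose j : ℂ) *
            f.eval (Complex.exp ((k : ℂ) * ε) * s))
        - (i.choose j : ℂ) * ε ^ (i - j) * (eulerOp^[i - j] f).eval s)
      =O[nhds (0 : ℂ)] fun ε : ℂ => ε ^ (i - j + 1) := by
  induction f using Polynomial.induction_on' with
  | add p q hp hq =>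
    refine (hp.add hq).congr_left fun ε => ?_
    simp only [eval_add, eulerOp_iterate_add, mul_add, Finset.sum_add_distrib]
    ring
  | monomial m a =>
    refine ((exp_mul_exp_sub_one_pow_sub_isBigO (j * m) m (i - j)).const_mul_left
      ((i.choose j : ℂ) * (a * s ^ m))).congr_left fun ε => ?_
    have hexp : ∀ k : ℕ, Complex.exp (k * ε) ^ m = Complex.exp (m * ε) ^ k := fun k => by
      rw [← Complex.exp_nat_mul, ← Complex.exp_nat_mul]
      ring_nf
    have hsum := sum_choose_mul_choose_mul_pow (Complex.exp (m * ε)) hij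
    have hj : Complex.exp ((j : ℂ) * m * ε) = Complex.exp (m * ε) ^ j := by
      rw [← Complex.exp_nat_mul, mul_assoc]
    simp only [eulerOp_iterate_monomial, eval_monomial, mul_pow, hexp]
    have hfac : ∑ k ∈ Finset.range (i + 1), (-1 : ℂ) ^ (i - k) * (i.choose k : ℂ) *
        (k.choose j : ℂ) * (a * (Complex.exp (m * ε) ^ k * s ^ m))
        = (a * s ^ m) * ((i.choose j : ℂ) *
          (Complex.exp (m * ε) ^ j * (Complex.exp (m * ε) - 1) ^ (i - j))) := by
      rw [← hsum, Finset.mul_sum]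
      exact Finset.sum_congr rfl fun k _ => by ring
    rw [hfac, hj]
    ring

end
end
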